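/- Let ℓ be a prime with ℓ > w and ℓ > 3, and let F be a field of characteristic ℓ. Let V_w(F) be the SL₂(F_ℓ)-module of polynomials over F of degree at most w, with action P|γ(X) = P((aX+b)/(cX+d))·(cX+d)^w for γ = [[a,b],[c,d]] ∈ SL₂(F_ℓ). Then the group cohomology H¹(SL₂(F_ℓ), V_w(F)) vanishes, unless ℓ = w+3, in which case it is one-dimensional over F. -/

import Mathlib

noncomputable section

namespace GC

variable {F : Type*} [Field F] {V : Type*} [AddCommGroup V] [Module F V]
variable {G : Type*} [Group G]

/-- Cocycles for a (right) action `ρ` of `G` on `V` by linear maps: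
`φ(gh) = φ(g)|h + φ(h)`. -/
def Z1 (ρ : G → V →ₗ[F] V) : Submodule F (G → V) where
  carrier := {φ | ∀ g h, φ (g * h) = ρ h (φ g) + φ h}
  add_mem' := by
    intro f g hf hg a b
    simp only [Pi.add_apply, hf a b, hg a b, _root_.map_add]
    abel
  zero_mem' := by intro a b; simp
  smul_mem' := by
    intro c f hf a b
    simp only [Pi.smul_apply, hf a b, _root_.map_smul, smul_add]

/-- Coboundaries: `φ(g) = v|g - v` for some `v ∈ V`. -/
def B1 (ρ : G → V →ₗ[F] V) : Submodule F (G → V) where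
  carrier := {φ | ∃ v, ∀ g, φ g = ρ g v - v}
  add_mem' := by
    rintro f g ⟨v, hv⟩ ⟨u, hu⟩
    exact ⟨v + u, fun x => by simp only [Pi.add_apply, hv x, hu x, _root_.map_add]; abel⟩
  zero_mem' := ⟨0, by simp⟩
  smul_mem' := by
    rintro c f ⟨v, hv⟩
    exact ⟨c • v, fun x => by simp only [Pi.smul_apply, hv x, _root_.map_smul, smul_sub]⟩

/-- First group cohomology `H¹(G, V) = Z¹/B¹` for the action `ρ`. -/
def H1 (ρ : G → V →ₗ[F] V) :=
  ↥(Z1 ρ) ⧸ ((B1 ρ ⊓ Z1 ρ).comap (Z1 ρ).subtype)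

instance (ρ : G → V →ₗ[F] V) : AddCommGroup (H1 ρ) := by
  unfold H1; infer_instance

instance (ρ : G → V →ₗ[F] V) : Module F (H1 ρ) := by
  unfold H1; infer_instance

/-- Restriction of cocycles along a group homomorphism. -/
def resZ (ρ : G → V →ₗ[F] V) {H : Type*} [Group H] (ι : H →* G) :
    ↥(Z1 ρ) →ₗ[F] ↥(Z1 (fun h => ρ (ι h))) :=
  LinearMap.codRestrict _ ((LinearMap.funLeft F V ι).comp (Z1 ρ).subtype)
    (by
      rintro ⟨φ, hφ⟩ g h
      simpa [LinearMap.funLeft, _root_.map_mul] using hφ (ι g) (ι h))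

/-- Restriction map in first group cohomology along a group homomorphism. -/
def resH1 (ρ : G → V →ₗ[F] V) {H : Type*} [Group H] (ι : H →* G) :
    H1 ρ →ₗ[F] H1 (fun h => ρ (ι h)) :=
  Submodule.mapQ _ _ (resZ ρ ι)
    (by
      rintro ⟨φ, hφ⟩ hmem
      rcases hmem.1 with ⟨v, hv⟩
      refine ⟨⟨v, fun h => ?_⟩, (resZ ρ ι ⟨φ, hφ⟩).2⟩
      have := hv (ι h)
      simpa [resZ, LinearMap.funLeft] using this)

/-- The invariants `H⁰(s, V) = {v | v|g = v for all g ∈ s}`. -/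
def invariants (ρ : G → V →ₗ[F] V) (s : Set G) : Submodule F V where
  carrier := {v | ∀ g ∈ s, ρ g v = v}
  add_mem' := by intro u v hu hv g hg; simp [_root_.map_add, hu g hg, hv g hg]
  zero_mem' := by intro g hg; simp
  smul_mem' := by intro c v hv g hg; simp [_root_.map_smul, hv g hg]

/-- The coefficient matrix of the weight `-w` slash action of the matrix
`[[a,b],[c,d]]` on polynomials of degree at most `w`, in the basis `1, X, …, X^w`:
`X^i ↦ (aX+b)^i (cX+d)^(w-i)`. -/
def slashCoeff (F : Type*) [Field F] (w : ℕ) (a b c d : F) :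
    Matrix (Fin (w+1)) (Fin (w+1)) F :=
  fun j i =>
    (((Polynomial.C a * Polynomial.X + Polynomial.C b) ^ (i : ℕ)) *
      ((Polynomial.C c * Polynomial.X + Polynomial.C d) ^ (w - (i : ℕ)))).coeff (j : ℕ)

/-- The weight `-w` slash action as a linear endomorphism of `V_w(F) ≅ F^{w+1}`
(coordinates with respect to the basis `1, X, …, X^w`). -/
def slashLin (F : Type*) [Field F] (w : ℕ) (a b c d : F) :
    (Fin (w+1) → F) →ₗ[F] (Fin (w+1) → F) :=
  Matrix.toLin' (slashCoeff F w a b c d)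

end GC

open GC Matrix MatrixGroups

/-- The right action of `SL₂(𝔽_ℓ)` on `V_w(F) ≅ F^{w+1}` (polynomials of degree at most
`w` over a field `F` of characteristic `ℓ`), given by
`P|γ(X) = P((aX+b)/(cX+d))·(cX+d)^w`, where the entries of `γ` are mapped to `F` via the
canonical ring map `ZMod ℓ →+* F`. -/
def rhoModp (F : Type*) [Field F] (ℓ w : ℕ) [CharP F ℓ] :
    Matrix.SpecialLinearGroup (Fin 2) (ZMod ℓ) →
      ((Fin (w+1) → F) →ₗ[F] (Fin (w+1) → F)) :=
  fun γ => slashLin F w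
    (ZMod.castHom dvd_rfl F (γ.1 0 0)) (ZMod.castHom dvd_rfl F (γ.1 0 1))
    (ZMod.castHom dvd_rfl F (γ.1 1 0)) (ZMod.castHom dvd_rfl F (γ.1 1 1))

namespace SLH

open Polynomial

section hev

variable {F : Type*} [Field F] {A : Type*} [CommRing A] [Algebra F A]

/-- Homogeneous evaluation: `∑ pᵢ xⁱ y^(n-i)`. -/
def hev (n : ℕ) (x y : A) : F[X] →ₗ[F] A :=
  (MvPolynomial.aeval ![x, y]).toLinearMap ∘ₗ homogenizeLM n

theorem hev_def (n : ℕ) (x y : A) (p : F[X]) :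
    hev n x y p = MvPolynomial.aeval ![x, y] (p.homogenize n) := rfl

theorem hev_sum (n : ℕ) (x y : A) (p : F[X]) :
    hev n x y p = ∑ i ∈ Finset.range (n + 1), p.coeff i • (x ^ i * y ^ (n - i)) := by
  rw [hev_def, homogenize, map_sum,
    Finset.Nat.sum_antidiagonal_eq_sum_range_succ_mk]
  refine Finset.sum_congr rfl fun i _ => ?_
  rw [MvPolynomial.aeval_monomial, Algebra.smul_def, Finsupp.prod_fintype _ _ (by simp)]
  simp

theorem hev_mul {m n : ℕ} (x y : A) {p q : F[X]} (hp : p.natDegree ≤ m) (hq : q.natDegree ≤ n) :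
    hev (m + n) x y (p * q) = hev m x y p * hev n x y q := by
  simp only [hev_def, homogenize_mul p q hp hq, map_mul]

theorem hev_lin (x y : A) (a b : F) : hev 1 x y (C a * X + C b) = a • x + b • y := by
  rw [hev_sum]
  simp [Finset.sum_range_succ, add_comm]

theorem hev_one (x y : A) : hev 0 x y (1 : F[X]) = 1 := by
  rw [hev_sum]; simp

theorem natDegree_lin (a b : F) : (C a * X + C b : F[X]).natDegree ≤ 1 := natDegree_linear_le

theorem hev_lin_pow (x y : A) (a b : F) (k : ℕ) :
    hev k x y ((C a * X + C b) ^ k) = (a • x + b • y) ^ k := by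
  induction k with
  | zero => simp [hev_one]
  | succ k ih =>
    rw [pow_succ, hev_mul x y _ (natDegree_lin a b), ih, hev_lin, pow_succ]
    exact (natDegree_pow_le_of_le k (natDegree_lin a b)).trans (by simp)

theorem natDegree_lin_pow (a b : F) (k : ℕ) : ((C a * X + C b : F[X]) ^ k).natDegree ≤ k :=
  (natDegree_pow_le_of_le k (natDegree_lin a b)).trans (by simp)

theorem hev_comp (n : ℕ) (x y : A) (a b c d : F) (p : F[X]) :
    hev n x y (hev n (C a * X + C b) (C c * X + C d) p) =
      hev n (a • x + b • y) (c • x + d • y) p := by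
  rw [hev_sum n (C a * X + C b), map_sum, hev_sum n (a • x + b • y)]
  refine Finset.sum_congr rfl fun i hi => ?_
  rw [map_smul]
  congr 1
  have hi : i ≤ n := Nat.lt_succ_iff.mp (Finset.mem_range.mp hi)
  have := hev_mul x y (natDegree_lin_pow a b i) (natDegree_lin_pow c d (n - i))
  rw [Nat.add_sub_cancel' hi] at this
  rw [this, hev_lin_pow, hev_lin_pow]

theorem hev_X_one (n : ℕ) {p : F[X]} (hp : p.natDegree ≤ n) : hev n (X : F[X]) 1 p = p := by
  rw [hev_def, aeval_homogenize_X_one p hp]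

theorem eval_hev (n : ℕ) (x y : F[X]) (t : F) (p : F[X]) :
    eval t (hev n x y p) = hev n (eval t x) (eval t y) p := by
  simp [hev_sum, eval_finsetSum]

theorem natDegree_hev_le (n : ℕ) (a b c d : F) (p : F[X]) :
    (hev n (C a * X + C b) (C c * X + C d) p).natDegree ≤ n := by
  rw [hev_sum]
  refine natDegree_sum_le_of_forall_le _ _ fun i hi => ?_
  have hi : i ≤ n := Nat.lt_succ_iff.mp (Finset.mem_range.mp hi)
  refine (natDegree_smul_le _ _).trans (natDegree_mul_le.trans ?_)
  have := natDegree_lin_pow a b i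
  have := natDegree_lin_pow c d (n - i)
  omega

theorem coeff_hev (n : ℕ) (a b c d : F) (p : F[X]) :
    (hev n (C a * X + C b) (C c * X + C d) p).coeff n = hev n a c p := by
  rw [hev_sum, hev_sum, finsetSum_coeff]
  refine Finset.sum_congr rfl fun i hi => ?_
  have hi : i ≤ n := Nat.lt_succ_iff.mp (Finset.mem_range.mp hi)
  rw [coeff_smul]
  congr 1
  have h := coeff_mul_add_eq_of_natDegree_le (natDegree_lin_pow a b i)
    (natDegree_lin_pow c d (n - i))
  rw [Nat.add_sub_cancel' hi] at h
  rw [h]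
  have h1 := coeff_pow_of_natDegree_le (m := i) (natDegree_lin a b)
  have h2 := coeff_pow_of_natDegree_le (m := n - i) (natDegree_lin c d)
  simp only [mul_one] at h1 h2
  rw [h1, h2]
  simp

end hev

section action

variable (F : Type*) [Field F] (ℓ : ℕ) [CharP F ℓ]

/-- entry cast -/
abbrev ec : ZMod ℓ →+* F := ZMod.castHom dvd_rfl F

/-- slash action of weight `n` on polynomials -/
def sl (n : ℕ) (g : SL(2, ZMod ℓ)) : F[X] →ₗ[F] F[X] :=
  hev n (C (ec F ℓ (g 0 0)) * X + C (ec F ℓ (g 0 1)))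
    (C (ec F ℓ (g 1 0)) * X + C (ec F ℓ (g 1 1)))

theorem sl_mul (n : ℕ) (g h : SL(2, ZMod ℓ)) (p : F[X]) :
    sl F ℓ n (g * h) p = sl F ℓ n h (sl F ℓ n g p) := by
  unfold sl
  rw [hev_comp]
  simp only [Matrix.SpecialLinearGroup.coe_mul, Matrix.mul_apply, Fin.sum_univ_two, map_add,
    map_mul, smul_eq_C_mul]
  congr 2 <;> ring

theorem sl_mul_mul (m n : ℕ) (g : SL(2, ZMod ℓ)) {p q : F[X]} (hp : p.natDegree ≤ m)
    (hq : q.natDegree ≤ n) :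
    sl F ℓ (m + n) g (p * q) = sl F ℓ m g p * sl F ℓ n g q := hev_mul _ _ hp hq

variable (w : ℕ)

/-- vectors to polynomials -/
def toP : (Fin (w + 1) → F) →ₗ[F] F[X] where
  toFun v := ∑ i : Fin (w + 1), monomial (i : ℕ) (v i)
  map_add' u v := by simp [Finset.sum_add_distrib]
  map_smul' c v := by simp [Finset.smul_sum, smul_monomial]

/-- polynomials to vectors -/
def frP : F[X] →ₗ[F] (Fin (w + 1) → F) where
  toFun p := fun i => p.coeff i
  map_add' u v := by ext; simp
  map_smul' c v := by ext; simp

variable {F w}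

theorem coeff_toP (v : Fin (w + 1) → F) (i : Fin (w + 1)) : (toP F w v).coeff i = v i := by
  simp only [toP, LinearMap.coe_mk, AddHom.coe_mk, finsetSum_coeff, coeff_monomial]
  simp [Fin.val_inj]

theorem natDegree_toP (v : Fin (w + 1) → F) : (toP F w v).natDegree ≤ w := by
  simp only [toP, LinearMap.coe_mk, AddHom.coe_mk]
  refine natDegree_sum_le_of_forall_le _ _ fun i _ => ?_
  exact (natDegree_monomial_le _).trans (Nat.lt_succ_iff.mp i.2)

theorem frP_toP (v : Fin (w + 1) → F) : frP F w (toP F w v) = v := by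
  ext i; exact coeff_toP v i

theorem toP_frP {p : F[X]} (hp : p.natDegree ≤ w) : toP F w (frP F w p) = p := by
  ext i
  by_cases hi : i < w + 1
  · exact coeff_toP _ ⟨i, hi⟩
  · rw [coeff_eq_zero_of_natDegree_lt, coeff_eq_zero_of_natDegree_lt]
    · omega
    · have := natDegree_toP (frP F w p); omega

theorem toP_inj {u v : Fin (w + 1) → F} (h : toP F w u = toP F w v) : u = v := by
  rw [← frP_toP u, h, frP_toP]

variable {ℓ}

theorem natDegree_sl (n : ℕ) (g : SL(2, ZMod ℓ)) (p : F[X]) : (sl F ℓ n g p).natDegree ≤ n :=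
  natDegree_hev_le _ _ _ _ _ _

theorem coeff_sl (n : ℕ) (g : SL(2, ZMod ℓ)) (p : F[X]) :
    (sl F ℓ n g p).coeff n = hev n (ec F ℓ (g 0 0)) (ec F ℓ (g 1 0)) p :=
  coeff_hev _ _ _ _ _ _

theorem toP_rho (g : SL(2, ZMod ℓ)) (v : Fin (w + 1) → F) :
    toP F w (rhoModp F ℓ w g v) = sl F ℓ w g (toP F w v) := by
  rw [← toP_frP (natDegree_sl w g (toP F w v))]
  congr 1
  ext j
  simp only [rhoModp, slashLin, Matrix.toLin'_apply, Matrix.mulVec, dotProduct, slashCoeff]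
  simp only [frP, LinearMap.coe_mk, AddHom.coe_mk, sl]
  rw [hev_sum, finsetSum_coeff, Finset.sum_range]
  refine Finset.sum_congr rfl fun i _ => ?_
  rw [coeff_toP, coeff_smul, smul_eq_mul, mul_comm]

theorem rho_frP (g : SL(2, ZMod ℓ)) {p : F[X]} (hp : p.natDegree ≤ w) :
    rhoModp F ℓ w g (frP F w p) = frP F w (sl F ℓ w g p) := by
  apply toP_inj
  rw [toP_rho, toP_frP hp, toP_frP (natDegree_sl _ _ _)]

theorem rho_mul (g h : SL(2, ZMod ℓ)) (v : Fin (w + 1) → F) :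
    rhoModp F ℓ w (g * h) v = rhoModp F ℓ w h (rhoModp F ℓ w g v) := by
  apply toP_inj
  rw [toP_rho, toP_rho, toP_rho, sl_mul]

theorem cobd_mem (v : Fin (w + 1) → F) :
    (fun g => rhoModp F ℓ w g v - v) ∈ Z1 (rhoModp F ℓ w) := by
  intro g h
  simp only [rho_mul, map_sub]
  abel

end action

end SLH
namespace SLH

open Polynomial

section cocycles

variable {F : Type*} [Field F] {ℓ : ℕ} [CharP F ℓ] {w : ℕ}

/-- upper unipotent -/
def un (x : ZMod ℓ) : SL(2, ZMod ℓ) := ⟨!![1, x; 0, 1], by simp⟩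

theorem coe_un (x : ZMod ℓ) : (un x : SL(2, ZMod ℓ)).1 = !![1, x; 0, 1] := rfl

/-- diagonal torus -/
def tor (a : (ZMod ℓ)ˣ) : SL(2, ZMod ℓ) :=
  ⟨!![(a : ZMod ℓ), 0; 0, ((a⁻¹ : (ZMod ℓ)ˣ) : ZMod ℓ)], by
    rw [Matrix.det_fin_two_of, Units.mul_inv]; ring⟩

theorem coe_tor (a : (ZMod ℓ)ˣ) :
    (tor a : SL(2, ZMod ℓ)).1 = !![(a : ZMod ℓ), 0; 0, ((a⁻¹ : (ZMod ℓ)ˣ) : ZMod ℓ)] := rfl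

theorem un_tor (a : (ZMod ℓ)ˣ) : un ((a : ZMod ℓ) * (a : ZMod ℓ)) * tor a = tor a * un 1 := by
  apply Subtype.ext
  rw [Matrix.SpecialLinearGroup.coe_mul, Matrix.SpecialLinearGroup.coe_mul, coe_un, coe_un,
    coe_tor]
  simp [mul_assoc]

theorem un_add (x y : ZMod ℓ) : un (x + y) = un x * un y := by
  apply Subtype.ext
  rw [Matrix.SpecialLinearGroup.coe_mul, coe_un, coe_un, coe_un]
  simp [add_comm]

theorem un_zero : un (0 : ZMod ℓ) = 1 := by
  ext i j
  fin_cases i <;> fin_cases j <;> simp [un]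

theorem hev_zero_right (n : ℕ) (a : F) (p : F[X]) : hev n a 0 p = p.coeff n * a ^ n := by
  rw [hev_sum, Finset.sum_range_succ, Finset.sum_eq_zero]
  · simp
  · intro i hi
    have : n - i ≠ 0 := by have := Finset.mem_range.mp hi; omega
    simp [this]

theorem last_rho (g : SL(2, ZMod ℓ)) (hg : g 1 0 = 0) (v : Fin (w + 1) → F) :
    rhoModp F ℓ w g v (Fin.last w) = v (Fin.last w) * ec F ℓ (g 0 0) ^ w := by
  rw [← coeff_toP (rhoModp F ℓ w g v), ← coeff_toP v, toP_rho, Fin.val_last, coeff_sl, hg, map_zero, hev_zero_right]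

theorem last_rho_un (x : ZMod ℓ) (v : Fin (w + 1) → F) :
    rhoModp F ℓ w (un x) v (Fin.last w) = v (Fin.last w) := by
  rw [last_rho _ (by simp [un])]
  simp [un]

variable (F ℓ w) in
/-- the leading coefficient functional -/
def lc : (SL(2, ZMod ℓ) → (Fin (w + 1) → F)) →ₗ[F] F where
  toFun φ := φ (un 1) (Fin.last w)
  map_add' _ _ := rfl
  map_smul' _ _ := rfl

theorem cocycle_one {φ : SL(2, ZMod ℓ) → (Fin (w + 1) → F)} (hφ : φ ∈ Z1 (rhoModp F ℓ w)) :
    rhoModp F ℓ w 1 (φ 1) = 0 := by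
  have := hφ 1 1
  rw [one_mul] at this
  exact right_eq_add.mp this

theorem last_un [NeZero ℓ] {φ : SL(2, ZMod ℓ) → (Fin (w + 1) → F)}
    (hφ : φ ∈ Z1 (rhoModp F ℓ w)) (x : ZMod ℓ) :
    φ (un x) (Fin.last w) = ec F ℓ x * lc F ℓ w φ := by
  obtain ⟨n, rfl⟩ := ZMod.natCast_zmod_surjective x
  induction n with
  | zero =>
    have h := cocycle_one hφ
    have h2 := last_rho_un 0 (φ (un (0 : ZMod ℓ)))
    rw [un_zero, h] at h2
    simp only [Nat.cast_zero, un_zero, ← h2]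
    simp
  | succ n ih =>
    have := hφ (un (n : ZMod ℓ)) (un 1)
    rw [← un_add] at this
    rw [Nat.cast_succ, this, Pi.add_apply, last_rho_un, ih, map_add, map_one, add_mul, one_mul]
    rfl

theorem lc_eq_zero (hℓ : ℓ.Prime) (hℓw : w < ℓ) (hℓ3 : 3 < ℓ) (hne : ℓ ≠ w + 3)
    {φ : SL(2, ZMod ℓ) → (Fin (w + 1) → F)}
    (hφ : φ ∈ Z1 (rhoModp F ℓ w)) : lc F ℓ w φ = 0 := by
  have : Fact ℓ.Prime := ⟨hℓ⟩
  obtain ⟨a, ha⟩ := IsCyclic.exists_generator (α := (ZMod ℓ)ˣ)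
  have hord : orderOf a = ℓ - 1 := by
    rw [orderOf_eq_card_of_forall_mem_zpowers ha, Nat.card_eq_fintype_card, ZMod.card_units]
  have h1 := congrFun (hφ (un ((a : ZMod ℓ) * (a : ZMod ℓ))) (tor a)) (Fin.last w)
  have h2 := congrFun (hφ (tor a) (un 1)) (Fin.last w)
  rw [un_tor, h2] at h1
  rw [Pi.add_apply, Pi.add_apply, last_rho_un, last_un hφ, last_rho (tor a) rfl, last_un hφ,
    map_one, one_mul] at h1
  have h3 : lc F ℓ w φ * (ec F ℓ (a : ZMod ℓ) ^ (w + 2) - 1) = 0 := by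
    have : ec F ℓ (tor a 0 0) = ec F ℓ (a : ZMod ℓ) := rfl
    rw [this, map_mul] at h1
    linear_combination -h1
  rcases mul_eq_zero.mp h3 with h | h
  · exact h
  · exfalso
    rw [sub_eq_zero, ← map_pow, ← map_one (ec F ℓ)] at h
    have h4 := (ec F ℓ).injective h
    have h5 : a ^ (w + 2) = 1 := by
      ext; push_cast; exact h4
    have h6 := orderOf_dvd_of_pow_eq_one h5
    rw [hord] at h6
    obtain ⟨k, hk⟩ := h6
    have hk2 : k < 2 := by
      by_contra hcon
      have : (ℓ - 1) * 2 ≤ (ℓ - 1) * k := Nat.mul_le_mul_left _ (by omega)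
      omega
    interval_cases k <;> omega

theorem sl_un (n : ℕ) (x : ZMod ℓ) {q : F[X]} (hq : q.natDegree ≤ n) :
    sl F ℓ n (un x) q = q.comp (X + C (ec F ℓ x)) := by
  unfold sl
  rw [hev_def, aeval_homogenize_of_eq_one hq _ (by simp [un])]
  simp [un, Polynomial.comp, aeval_def, Polynomial.algebraMap_eq]

theorem exists_diff {ℓ : ℕ} [CharP F ℓ] (n : ℕ) (hn : n < ℓ) (p : F[X]) (hp : p.degree < n) :
    ∃ q : F[X], q.natDegree ≤ n ∧ q.comp (X + 1) - q = p := by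
  induction n generalizing p with
  | zero =>
    refine ⟨0, by simp, ?_⟩
    have : p = 0 := by
      rw [← degree_eq_bot]; simpa using hp
    simp [this]
  | succ n ih =>
    have hne : ((n + 1 : ℕ) : F) ≠ 0 := by
      rw [Ne, CharP.cast_eq_zero_iff F ℓ]
      exact Nat.not_dvd_of_pos_of_lt (Nat.succ_pos n) hn
    set c := p.coeff n / ((n + 1 : ℕ) : F) with hc
    obtain ⟨q, hq, hqe⟩ := ih (by omega) (p - C c * ((X + 1) ^ (n + 1) - X ^ (n + 1))) (by
      rw [degree_lt_iff_coeff_zero]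
      intro m hm
      rw [degree_lt_iff_coeff_zero] at hp
      rw [coeff_sub, coeff_C_mul, coeff_sub, coeff_X_add_one_pow, coeff_X_pow]
      rcases Nat.lt_or_ge n m with h | h
      · rw [hp m h]
        rcases Nat.lt_or_ge (n + 1) m with h' | h'
        · rw [Nat.choose_eq_zero_of_lt h', if_neg (by omega)]; simp
        · have : m = n + 1 := by omega
          subst this
          simp
      · have : m = n := by omega
        subst this
        rw [if_neg (by omega), Nat.choose_succ_self_right, sub_zero, hc, div_mul_cancel₀ _ hne,
          sub_self])
    refine ⟨q + C c * X ^ (n + 1), ?_, ?_⟩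
    · refine natDegree_add_le_of_degree_le (by omega) (natDegree_C_mul_X_pow_le _ _)
    · simp only [add_comp, mul_comp, C_comp, X_pow_comp]
      linear_combination hqe

theorem row_eq {φ : SL(2, ZMod ℓ) → (Fin (w + 1) → F)} (hφ : φ ∈ Z1 (rhoModp F ℓ w))
    (h0 : ∀ x, φ (un x) = 0) (g g' : SL(2, ZMod ℓ)) (h : g 1 = g' 1) : φ g = φ g' := by
  have hd := g.det_coe
  have hd' := g'.det_coe
  rw [Matrix.det_fin_two] at hd hd'
  have e0 : g 1 0 = g' 1 0 := congrFun h 0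
  have e1 : g 1 1 = g' 1 1 := congrFun h 1
  have : g = un (g 0 1 * g' 0 0 - g 0 0 * g' 0 1) * g' := by
    ext i j
    rw [Matrix.SpecialLinearGroup.coe_mul, coe_un, Matrix.mul_apply, Fin.sum_univ_two]
    fin_cases i <;> fin_cases j <;> simp <;> grind
  rw [this, hφ, h0, map_zero, zero_add]

theorem transfer (hℓ : ℓ.Prime) {φ : SL(2, ZMod ℓ) → (Fin (w + 1) → F)}
    (hφ : φ ∈ Z1 (rhoModp F ℓ w)) (h0 : ∀ x, φ (un x) = 0) :
    ∃ v, ∀ g, φ g = rhoModp F ℓ w g v - v := by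
  classical
  have : Fact ℓ.Prime := ⟨hℓ⟩
  have hs : ∀ r : {r : Fin 2 → ZMod ℓ // r ≠ 0}, ∃ g : SL(2, ZMod ℓ), g 1 = r.1 := by
    rintro ⟨r, hr⟩
    by_cases h : r 0 = 0
    · have h1 : r 1 ≠ 0 := by
        intro h1; apply hr; ext i; fin_cases i <;> simp [h, h1]
      refine ⟨⟨!![(r 1)⁻¹, 0; r 0, r 1], by simp [h1]⟩, ?_⟩
      ext i; fin_cases i <;> simp
    · refine ⟨⟨!![0, -(r 0)⁻¹; r 0, r 1], by simp [h]⟩, ?_⟩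
      ext i; fin_cases i <;> simp
  choose s hs using hs
  refine ⟨∑ r, φ (s r), fun h => ?_⟩
  have hinj : Function.Injective (fun r : Fin 2 → ZMod ℓ => r ᵥ* h.1) :=
    Matrix.vecMul_injective_of_isUnit
      ((Matrix.isUnit_iff_isUnit_det _).mpr (by rw [h.2]; exact isUnit_one))
  let e : {r : Fin 2 → ZMod ℓ // r ≠ 0} → {r : Fin 2 → ZMod ℓ // r ≠ 0} := fun r =>
    ⟨r.1 ᵥ* h.1, fun hr => r.2 (hinj (by simpa using hr))⟩
  have he : Function.Bijective e := by
    rw [← Finite.injective_iff_bijective]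
    intro r r' hrr
    exact Subtype.ext (hinj (congrArg Subtype.val hrr))
  have key : ∀ r, φ (s (e r)) = rhoModp F ℓ w h (φ (s r)) + φ h := by
    intro r
    rw [← hφ]
    apply row_eq hφ h0
    rw [hs]
    ext j
    simp [e, ← hs r, Matrix.vecMul, dotProduct, Matrix.mul_apply]
  have hsum := he.sum_comp (fun r => φ (s r))
  simp only [key, Finset.sum_add_distrib, Finset.sum_const, Finset.card_univ] at hsum
  have hcard : Fintype.card {r : Fin 2 → ZMod ℓ // r ≠ 0} + 1 = ℓ ^ 2 := by
    have := Fintype.card_subtype_compl (fun r : Fin 2 → ZMod ℓ => r = 0)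
    rw [Fintype.card_subtype_eq] at this
    simp only [Fintype.card_fun, ZMod.card, Fintype.card_fin] at this
    have hp : 0 < ℓ ^ 2 := pow_pos hℓ.pos 2
    simp only [ne_eq]
    omega
  have hc : ((Fintype.card {r : Fin 2 → ZMod ℓ // r ≠ 0} : ℕ) : F) = -1 := by
    have := congrArg (Nat.cast : ℕ → F) hcard
    push_cast at this
    rw [CharP.cast_eq_zero F ℓ] at this
    linear_combination this
  rw [← Nat.cast_smul_eq_nsmul F, hc, neg_one_smul, ← map_sum] at hsum
  rw [← sub_eq_zero] at hsum ⊢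
  rw [← neg_eq_zero, ← hsum]
  abel

theorem mem_B1_of_lc (hℓ : ℓ.Prime) (hℓw : w < ℓ) {φ : SL(2, ZMod ℓ) → (Fin (w + 1) → F)}
    (hφ : φ ∈ Z1 (rhoModp F ℓ w)) (h : lc F ℓ w φ = 0) : φ ∈ B1 (rhoModp F ℓ w) := by
  have : Fact ℓ.Prime := ⟨hℓ⟩
  have hdeg : (toP F w (φ (un 1))).degree < w := by
    rw [degree_lt_iff_coeff_zero]
    intro m hm
    rcases hm.eq_or_lt with rfl | hm
    · exact (coeff_toP _ (Fin.last w)).trans h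
    · exact coeff_eq_zero_of_natDegree_lt ((natDegree_toP _).trans_lt hm)
  obtain ⟨q, hq, hqe⟩ := exists_diff w hℓw _ hdeg
  have hψ := sub_mem hφ (cobd_mem (ℓ := ℓ) (frP F w q))
  set ψ := φ - fun g => rhoModp F ℓ w g (frP F w q) - frP F w q with hψd
  have h1 : ψ (un 1) = 0 := by
    apply toP_inj
    rw [hψd, Pi.sub_apply, map_sub, ← hqe, map_sub, toP_rho, toP_frP hq, sl_un _ _ hq]
    simp
  have h0 : ∀ x, ψ (un x) = 0 := by
    intro x
    obtain ⟨n, rfl⟩ := ZMod.natCast_zmod_surjective x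
    induction n with
    | zero =>
      have h := hψ 1 (un 1)
      rw [one_mul, h1, add_zero] at h
      have h2 := hψ (un 1) 1
      have h3 := cocycle_one hψ
      rw [mul_one, h1, map_zero, zero_add] at h2
      rw [Nat.cast_zero, un_zero, ← h2]
    | succ n ih => rw [Nat.cast_succ, un_add, hψ, ih, h1, map_zero, zero_add]
  obtain ⟨v, hv⟩ := transfer hℓ hψ h0
  refine ⟨v + frP F w q, fun g => ?_⟩
  have := hv g
  rw [hψd, Pi.sub_apply, sub_eq_iff_eq_add] at this
  rw [this, map_add]
  abel

theorem lc_of_mem_B1 {φ : SL(2, ZMod ℓ) → (Fin (w + 1) → F)}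
    (hφ : φ ∈ B1 (rhoModp F ℓ w)) : lc F ℓ w φ = 0 := by
  obtain ⟨v, hv⟩ := hφ
  change φ (un 1) (Fin.last w) = 0
  rw [hv, Pi.sub_apply, last_rho_un, sub_self]

end cocycles

end SLH
namespace SLH

open Polynomial

section construction

variable {F : Type*} [Field F] {w : ℕ}

variable (F w) in
/-- the Dickson invariant (dehomogenized) -/
def th : F[X] := X ^ (w + 3) - X

variable (F w) in
/-- a form of degree `2ℓ - 2` which is `1` at all nonzero points -/
def Q : F[X] := X ^ (2 * w + 4) - X ^ (w + 2) + 1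

theorem natDegree_th : (th F w).natDegree = w + 3 :=
  FiniteField.X_pow_card_sub_X_natDegree_eq F (by omega)

theorem monic_th : (th F w).Monic := by
  unfold th
  apply monic_X_pow_sub
  rw [degree_X]
  exact_mod_cast (by omega : 1 < w + 3)

theorem natDegree_Q : (Q F w).natDegree ≤ 2 * w + 4 := by
  unfold Q
  have h1 : (X ^ (w + 2) : F[X]).natDegree ≤ 2 * w + 4 := by
    rw [natDegree_X_pow]; omega
  have h2 : (X ^ (2 * w + 4) - X ^ (w + 2) : F[X]).natDegree ≤ 2 * w + 4 := by
    have := natDegree_sub_le_of_le (natDegree_X_pow_le (R := F) (2 * w + 4)) h1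
    rwa [max_self] at this
  have h3 : (1 : F[X]).natDegree ≤ 2 * w + 4 := by rw [natDegree_one]; omega
  exact natDegree_add_le_of_degree_le h2 h3

theorem coeff_Q : (Q F w).coeff (2 * w + 4) = 1 := by
  simp only [Q, coeff_add, coeff_sub, coeff_X_pow, coeff_one]
  rw [if_pos trivial, if_neg (by omega), if_neg (by omega)]
  ring

theorem hev_X_pow {A : Type*} [CommRing A] [Algebra F A] {n i : ℕ} (h : i ≤ n) (x y : A) :
    hev n x y (X ^ i : F[X]) = x ^ i * y ^ (n - i) := by
  rw [hev_def, homogenize_X_pow h]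
  simp

theorem hev_Q {A : Type*} [CommRing A] [Algebra F A] (x y : A) :
    hev (2 * w + 4) x y (Q F w) =
      (x ^ (w + 2)) ^ 2 - x ^ (w + 2) * y ^ (w + 2) + (y ^ (w + 2)) ^ 2 := by
  unfold Q
  rw [map_add, map_sub, hev_X_pow le_rfl, hev_X_pow (by omega), ← pow_zero X,
    hev_X_pow (Nat.zero_le _)]
  have : 2 * w + 4 - (w + 2) = w + 2 := by omega
  rw [this]
  simp only [Nat.sub_self, Nat.sub_zero]
  ring

theorem hev_th {A : Type*} [CommRing A] [Algebra F A] (x y : A) :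
    hev (w + 4) x y (th F w) = x ^ (w + 3) * y - x * y ^ (w + 3) := by
  unfold th
  rw [map_sub, hev_X_pow (by omega)]
  have h : hev (w + 4) x y (X : F[X]) = x * y ^ (w + 3) := by
    have := hev_X_pow (F := F) (show 1 ≤ w + 4 by omega) x y
    simpa using this
  rw [h]
  have : w + 4 - (w + 3) = 1 := by omega
  rw [this, pow_one]

variable [CharP F (w + 3)]

theorem sl_th (hℓ : (w + 3).Prime) (g : SL(2, ZMod (w + 3))) : sl F (w + 3) (w + 4) g (th F w) = th F w := by
  have : Fact (w + 3).Prime := ⟨hℓ⟩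
  unfold sl
  have frob : ∀ a b : ZMod (w + 3), (C (ec F (w + 3) a) * X + C (ec F (w + 3) b)) ^ (w + 3) =
      C (ec F (w + 3) a) * X ^ (w + 3) + C (ec F (w + 3) b) := by
    intro a b
    rw [add_pow_char, mul_pow, ← C_pow, ← C_pow, ← map_pow, ← map_pow, ZMod.pow_card,
      ZMod.pow_card]
  rw [hev_th, frob, frob]
  have hd := g.det_coe
  rw [Matrix.det_fin_two] at hd
  have hd2 := congrArg (fun z => (C (ec F (w + 3) z) : F[X])) hd
  simp only [map_sub, map_mul, map_one] at hd2
  unfold th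
  linear_combination (X ^ (w + 3) - X) * hd2

theorem hev_Q_eq_one (hℓ : (w + 3).Prime) (a c : ZMod (w + 3)) (h : a ≠ 0 ∨ c ≠ 0) :
    hev (2 * w + 4) (ec F (w + 3) a) (ec F (w + 3) c) (Q F w) = 1 := by
  have : Fact (w + 3).Prime := ⟨hℓ⟩
  have h1 : ∀ a : ZMod (w + 3), a ≠ 0 → ec F (w + 3) a ^ (w + 2) = 1 := by
    intro a ha
    rw [← map_pow]
    have := ZMod.pow_card_sub_one_eq_one ha
    rw [show w + 3 - 1 = w + 2 by omega] at this
    rw [this, map_one]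
  rw [hev_Q]
  by_cases ha : a = 0
  · have hc : c ≠ 0 := by tauto
    rw [h1 c hc, ha]
    simp
  · rw [h1 a ha]
    by_cases hc : c = 0
    · rw [hc]; simp
    · rw [h1 c hc]; ring

variable (F) in
/-- the coboundary of `Q` -/
def D (g : SL(2, ZMod (w + 3))) : F[X] := sl F (w + 3) (2 * w + 4) g (Q F w) - Q F w

theorem natDegree_D (hℓ : (w + 3).Prime) (g : SL(2, ZMod (w + 3))) : (D F g).natDegree ≤ 2 * w + 3 := by
  have : Fact (w + 3).Prime := ⟨hℓ⟩
  rw [natDegree_le_iff_coeff_eq_zero]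
  intro m hm
  rcases (show 2 * w + 4 ≤ m by omega).eq_or_lt with rfl | hm
  · have hd := g.det_coe
    rw [Matrix.det_fin_two] at hd
    rw [D, coeff_sub, coeff_sl, coeff_Q, hev_Q_eq_one hℓ, sub_self]
    by_contra! hcon
    rw [hcon.1, hcon.2] at hd
    simp at hd
  · rw [D, coeff_sub, coeff_eq_zero_of_natDegree_lt ((natDegree_sl _ _ _).trans_lt hm),
      coeff_eq_zero_of_natDegree_lt (natDegree_Q.trans_lt hm), sub_zero]

theorem eval_D (hℓ : (w + 3).Prime) (g : SL(2, ZMod (w + 3))) (t : ZMod (w + 3)) :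
    eval (ec F (w + 3) t) (D F g) = 0 := by
  have : Fact (w + 3).Prime := ⟨hℓ⟩
  have hd := g.det_coe
  rw [Matrix.det_fin_two] at hd
  have h1 : eval (ec F (w + 3) t) (Q F w) = 1 := by
    have := eval_hev (2 * w + 4) X 1 (ec F (w + 3) t) (Q F w)
    rw [hev_X_one _ natDegree_Q] at this
    rw [this, eval_X, eval_one, ← map_one (ec F (w + 3)), hev_Q_eq_one hℓ, map_one]
    simp
  rw [D, eval_sub, h1, sl, eval_hev]
  simp only [eval_add, eval_mul, eval_C, eval_X, ← map_mul, ← map_add]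
  rw [hev_Q_eq_one hℓ, sub_self]
  by_contra! hcon
  have : (1 : ZMod (w + 3)) = 0 := by
    rw [← hd]
    linear_combination g 0 0 * hcon.2 - g 1 0 * hcon.1
  exact one_ne_zero this

theorem D_eq (hℓ : (w + 3).Prime) (g : SL(2, ZMod (w + 3))) : th F w * (D F g /ₘ th F w) = D F g := by
  have : Fact (w + 3).Prime := ⟨hℓ⟩
  have h := modByMonic_add_div (D F g) (th F w)
  suffices hz : D F g %ₘ th F w = 0 by rw [hz, zero_add] at h; exact h
  refine eq_zero_of_natDegree_lt_card_of_eval_eq_zero _ (ec F (w + 3)).injective ?_ ?_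
  · intro t
    have h2 := congrArg (eval (ec F (w + 3) t)) h
    rw [eval_D hℓ, eval_add, eval_mul] at h2
    have h3 : eval (ec F (w + 3) t) (th F w) = 0 := by
      rw [th, eval_sub, eval_pow, eval_X, ← map_pow, ZMod.pow_card, sub_self]
    rw [h3, zero_mul, add_zero] at h2
    exact h2
  · rw [ZMod.card]
    have := natDegree_modByMonic_lt (D F g) (monic_th (F := F) (w := w)) (by
      intro h1
      have := natDegree_th (F := F) (w := w)
      rw [h1] at this
      simp at this)
    rwa [natDegree_th] at this

theorem natDegree_E (hℓ : (w + 3).Prime) (g : SL(2, ZMod (w + 3))) : (D F g /ₘ th F w).natDegree ≤ w := by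
  rw [natDegree_divByMonic _ monic_th, natDegree_th]
  have := natDegree_D (F := F) hℓ g
  omega

variable (F) in
/-- the explicit cocycle -/
def coc (g : SL(2, ZMod (w + 3))) : Fin (w + 1) → F := frP F w (D F g /ₘ th F w)

theorem coc_mem (hℓ : (w + 3).Prime) : (coc F : SL(2, ZMod (w + 3)) → _) ∈ Z1 (rhoModp F (w + 3) w) := by
  intro g h
  apply toP_inj
  rw [map_add, toP_rho, coc, coc, coc, toP_frP (natDegree_E hℓ _), toP_frP (natDegree_E hℓ _),
    toP_frP (natDegree_E hℓ _)]
  apply mul_left_cancel₀ (monic_th (F := F) (w := w)).ne_zero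
  have h1 := sl_mul_mul F (w + 3) (w + 4) w h (natDegree_th (F := F) (w := w) |>.le.trans
    (by omega)) (natDegree_E (F := F) hℓ g)
  rw [sl_th hℓ, D_eq hℓ, show w + 4 + w = 2 * w + 4 by ring] at h1
  rw [mul_add, ← h1, D_eq hℓ, D_eq hℓ]
  simp only [D, map_sub, sl_mul]
  ring

theorem lc_coc (hℓ : (w + 3).Prime) (hw : 0 < w) : lc F (w + 3) w (coc F) = -2 := by
  have h1 : lc F (w + 3) w (coc F) = (D F (un 1 : SL(2, ZMod (w + 3))) /ₘ th F w).coeff w := rfl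
  have h2 := coeff_mul_add_eq_of_natDegree_le (natDegree_th (F := F) (w := w)).le
    (natDegree_E (F := F) hℓ (un 1))
  have h3 : (th F w).coeff (w + 3) = 1 := by
    have := monic_th (F := F) (w := w)
    rwa [Monic, leadingCoeff, natDegree_th] at this
  rw [D_eq hℓ, h3, one_mul] at h2
  rw [h1, ← h2, D, sl_un _ _ natDegree_Q]
  have h0 := CharP.cast_eq_zero F (w + 3)
  push_cast at h0
  simp only [Q, map_one, add_comp, sub_comp, X_pow_comp, one_comp, coeff_sub, coeff_add,
    coeff_X_add_one_pow, coeff_X_pow, coeff_one]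
  rw [if_neg (by omega), if_neg (by omega), if_neg (by omega),
    Nat.choose_eq_zero_of_lt (show w + 2 < w + 3 + w by omega),
    show 2 * w + 4 = (w + 3 + w) + 1 by ring, Nat.choose_succ_self_right]
  push_cast
  linear_combination 2 * h0

end construction

section final

variable {F : Type*} [Field F] {ℓ : ℕ} [CharP F ℓ] {w : ℕ}

theorem ker_eq (hℓ : ℓ.Prime) (hℓw : w < ℓ) :
    (B1 (rhoModp F ℓ w) ⊓ Z1 (rhoModp F ℓ w)).comap (Z1 (rhoModp F ℓ w)).subtype =
      LinearMap.ker ((lc F ℓ w) ∘ₗ (Z1 (rhoModp F ℓ w)).subtype) := by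
  ext ⟨φ, hφ⟩
  simp only [Submodule.mem_comap, Submodule.mem_inf, LinearMap.mem_ker, LinearMap.comp_apply,
    Submodule.subtype_apply]
  exact ⟨fun h => lc_of_mem_B1 h.1, fun h => ⟨mem_B1_of_lc hℓ hℓw hφ h, hφ⟩⟩

end final

end SLH

/-- **Vanishing of `H¹(SL₂(𝔽_ℓ), V_w(F))`.**
Let `ℓ > w`, `ℓ > 3` be a prime and let `F` be a field of characteristic `ℓ`.  Then the
group cohomology `H¹(SL₂(𝔽_ℓ), V_w(F))` vanishes, unless `ℓ = w + 3`, in which case it is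
one-dimensional over `F`. -/
theorem H1_SL2_Fl_vanishes (ℓ w : ℕ) (hℓ : ℓ.Prime) (hℓw : w < ℓ) (hℓ3 : 3 < ℓ)
    {F : Type*} [Field F] [CharP F ℓ] :
    (ℓ ≠ w + 3 → ∀ x : H1 (rhoModp F ℓ w), x = 0) ∧
    (ℓ = w + 3 → Module.finrank F (H1 (rhoModp F ℓ w)) = 1) := by
  constructor
  · intro hne x
    obtain ⟨φ, rfl⟩ := Submodule.Quotient.mk_surjective
      ((B1 (rhoModp F ℓ w) ⊓ Z1 (rhoModp F ℓ w)).comap (Z1 (rhoModp F ℓ w)).subtype) x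
    refine (Submodule.Quotient.mk_eq_zero _).mpr ?_
    rw [SLH.ker_eq hℓ hℓw]
    exact SLH.lc_eq_zero hℓ hℓw hℓ3 hne φ.2
  · rintro rfl
    have hsurj : Function.Surjective
        ((SLH.lc F (w + 3) w) ∘ₗ (Z1 (rhoModp F (w + 3) w)).subtype) := by
      apply LinearMap.surjective
      intro h0
      have h1 := LinearMap.congr_fun h0 ⟨SLH.coc F, SLH.coc_mem hℓ⟩
      change SLH.lc F (w + 3) w (SLH.coc F) = 0 at h1
      rw [SLH.lc_coc hℓ (by omega), neg_eq_zero] at h1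
      have h2 : ((2 : ℕ) : F) = 0 := by exact_mod_cast h1
      rw [CharP.cast_eq_zero_iff F (w + 3)] at h2
      have := Nat.le_of_dvd (by omega) h2
      omega
    let e := (Submodule.quotEquivOfEq _ _ (SLH.ker_eq (F := F) hℓ hℓw)).trans
      (LinearMap.quotKerEquivOfSurjective _ hsurj)
    have h := e.finrank_eq
    rw [Module.finrank_self] at h
    exact h
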